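/- Let a > 0, let p : ℝ³ → ℂ be integrable and vanish outside the closed ball of radius a, and define P(z) := ∫_{ℝ³} p(x) e^{i z·x} dx for z ∈ ℂ³, where z·x := z₁x₁ + z₂x₂ + z₃x₃. Let η₀ > 0. If P(2(k+iη)β) = 0 for all k > 0, all η > η₀, and all β ∈ S², then p = 0 almost everywhere. -/

import Mathlib

open MeasureTheory Complex

noncomputable section

abbrev E3 : Type := EuclideanSpace ℝ (Fin 3)

/-- The unit sphere `S²` in `ℝ³`. -/
def sphere2 : Set E3 := {β : E3 | ‖β‖ = 1}

/-- The bilinear pairing `z·x = z₁x₁ + z₂x₂ + z₃x₃` of a complex vector with a real vector. -/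
def cdot (z : Fin 3 → ℂ) (x : E3) : ℂ := ∑ j : Fin 3, z j * (x j : ℂ)

/-- The entire extension `P(z) = ∫ p(x) e^{i z·x} dx` of the Fourier transform of `p` to `ℂ³`. -/
def FT3 (p : E3 → ℂ) (z : Fin 3 → ℂ) : ℂ :=
  ∫ x : E3, p x * Complex.exp (Complex.I * cdot z x)

end

open scoped FourierTransform ContDiff in
/-- The Fourier transform is injective on integrable functions. -/
theorem ae_eq_zero_of_fourier_eq_zero {V E : Type*} [NormedAddCommGroup V] [InnerProductSpace ℝ V]
    [FiniteDimensional ℝ V] [MeasurableSpace V] [BorelSpace V] [NormedAddCommGroup E]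
    [NormedSpace ℂ E] [CompleteSpace E] {f : V → E} (hf : Integrable f)
    (h : ∀ w, 𝓕 f w = 0) : f =ᵐ[volume] 0 := by
  refine ae_eq_zero_of_integral_contDiff_smul_eq_zero hf.locallyIntegrable fun g hg hgs => ?_
  have hgs' : HasCompactSupport (Complex.ofRealCLM ∘ g) := hgs.comp_left rfl
  set ψ := hgs'.toSchwartzMap (Complex.ofRealCLM.contDiff.comp hg) with hψ
  have key : ∫ ξ, (𝓕 (𝓕⁻ ψ : SchwartzMap V ℂ)) ξ • f ξ
      = ∫ x, (𝓕⁻ ψ : SchwartzMap V ℂ) x • 𝓕 f x := by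
    have := VectorFourier.integral_fourierIntegral_smul_eq_flip (L := innerₗ V)
      Real.continuous_fourierChar continuous_inner
      ((𝓕⁻ ψ : SchwartzMap V ℂ).integrable (μ := volume)) hf
    rwa [flip_innerₗ] at this
  rw [FourierTransform.fourier_fourierInv_eq] at key
  simpa [h, hψ] using key

/-- If `g` is bounded on the support of the integrable function `p`, then
`s ↦ ∫ p(x) e^{i s g(x)} dμ(x)` is entire. -/
theorem differentiable_integral_mul_cexp {α : Type*} [MeasurableSpace α] {μ : Measure α}
    {p : α → ℂ} (hp : Integrable p μ) {g : α → ℝ} (hg : AEStronglyMeasurable g μ) {c : ℝ}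
    (hc : ∀ x, p x ≠ 0 → |g x| ≤ c) :
    Differentiable ℂ fun s : ℂ => ∫ x, p x * Complex.exp (Complex.I * (s * (g x : ℂ))) ∂μ := by
  intro s₀
  have hgC : AEStronglyMeasurable (fun x => (g x : ℂ)) μ :=
    Complex.continuous_ofReal.comp_aestronglyMeasurable hg
  have hmeas (s : ℂ) :
      AEStronglyMeasurable (fun x => p x * Complex.exp (Complex.I * (s * (g x : ℂ)))) μ :=
    hp.1.mul (Complex.continuous_exp.comp_aestronglyMeasurable ((hgC.const_mul s).const_mul _))
  have hexp (s : ℂ) (x : α) (hx : p x ≠ 0) :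
      ‖Complex.exp (Complex.I * (s * (g x : ℂ)))‖ ≤ Real.exp (‖s‖ * c) := by
    refine (Complex.norm_exp_le_exp_norm _).trans (Real.exp_le_exp.2 ?_)
    have := hc x hx
    simp only [norm_mul, Complex.norm_I, one_mul, Complex.norm_real, Real.norm_eq_abs]
    gcongr
  have hint : Integrable (fun x => p x * Complex.exp (Complex.I * (s₀ * (g x : ℂ)))) μ := by
    refine (hp.norm.mul_const (Real.exp (‖s₀‖ * c))).mono' (hmeas s₀) (.of_forall fun x => ?_)
    by_cases hx : p x = 0
    · simp [hx]
    · rw [norm_mul]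
      gcongr
      exact hexp s₀ x hx
  have hbound : ∀ᵐ x ∂μ, ∀ s ∈ Metric.ball s₀ 1,
      ‖p x * Complex.exp (Complex.I * (s * (g x : ℂ))) * (Complex.I * (g x : ℂ))‖
        ≤ ‖p x‖ * (Real.exp ((‖s₀‖ + 1) * c) * c) := by
    refine .of_forall fun x s hs => ?_
    by_cases hx : p x = 0
    · simp [hx]
    · have hgx := hc x hx
      have hc0 : 0 ≤ c := (abs_nonneg _).trans hgx
      have hs' : ‖s‖ ≤ ‖s₀‖ + 1 := by
        have := norm_le_norm_add_norm_sub' s s₀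
        rw [Metric.mem_ball, dist_eq_norm] at hs
        linarith
      rw [norm_mul, norm_mul, mul_assoc]
      gcongr
      · exact (hexp s x hx).trans (by gcongr)
      · simpa using hgx
  refine (hasDerivAt_integral_of_dominated_loc_of_deriv_le
    (F' := fun s x => p x * Complex.exp (Complex.I * (s * (g x : ℂ))) * (Complex.I * (g x : ℂ)))
    (Metric.ball_mem_nhds s₀ one_pos) (.of_forall hmeas) hint
    ((hmeas s₀).mul (hgC.const_mul _)) hbound (hp.norm.mul_const _)
    (.of_forall fun x s _ => ?_)).2.differentiableAt
  have := ((((hasDerivAt_id s).mul_const (g x : ℂ)).const_mul Complex.I).cexp).const_mul (p x)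
  simpa [mul_assoc] using this

theorem cdot_mul_ofReal (s : ℂ) (β x : E3) :
    cdot (fun j => s * ((β j : ℝ) : ℂ)) x = s * ((inner ℝ β x : ℝ) : ℂ) := by
  simp only [cdot, PiLp.inner_apply, RCLike.inner_apply, conj_trivial, Complex.ofReal_sum,
    Complex.ofReal_mul, Finset.mul_sum]
  exact Finset.sum_congr rfl fun j _ => by ring

open scoped FourierTransform in
theorem fourier_eq_FT3 (p : E3 → ℂ) (w : E3) :
    𝓕 p w = FT3 p (fun j => ((-2 * Real.pi : ℝ) : ℂ) * ((w j : ℝ) : ℂ)) := by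
  rw [Real.fourier_eq', FT3]
  congr 1 with x
  rw [cdot_mul_ofReal, smul_eq_mul, mul_comm, real_inner_comm w x]
  congr 2
  push_cast
  ring

/-- If `p` has bounded support and its extended Fourier transform vanishes at `2(k+iη)β` for a
fixed unit vector `β` and all `k > 0`, `η > η₀`, then it vanishes on the complex line `ℂβ`. -/
theorem FT3_line_eq_zero {a η₀ : ℝ} {p : E3 → ℂ} (hp : Integrable p)
    (hsupp : ∀ x : E3, a < ‖x‖ → p x = 0) {β : E3} (hβ : β ∈ sphere2)
    (h : ∀ k > (0 : ℝ), ∀ η > η₀,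
      FT3 p (fun j => 2 * ((k : ℂ) + (η : ℂ) * Complex.I) * ((β j : ℝ) : ℂ)) = 0) (s : ℂ) :
    FT3 p (fun j => s * ((β j : ℝ) : ℂ)) = 0 := by
  have hd : Differentiable ℂ fun s : ℂ => FT3 p (fun j => s * ((β j : ℝ) : ℂ)) := by
    simp only [FT3, cdot_mul_ofReal]
    refine differentiable_integral_mul_cexp hp (c := a)
      (continuous_const.inner continuous_id).aestronglyMeasurable fun x hx => ?_
    have hxa : ‖x‖ ≤ a := not_lt.1 fun hlt => hx (hsupp x hlt)
    have hβ' : ‖β‖ = 1 := hβ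
    simpa [hβ'] using (abs_real_inner_le_norm β x).trans (by simpa [hβ'] using hxa)
  have hopen : IsOpen {s : ℂ | 0 < s.re ∧ 2 * η₀ < s.im} :=
    (isOpen_lt continuous_const Complex.continuous_re).inter
      (isOpen_lt continuous_const Complex.continuous_im)
  have hmem : (⟨1, 2 * η₀ + 1⟩ : ℂ) ∈ {s : ℂ | 0 < s.re ∧ 2 * η₀ < s.im} := by simp
  have hev : (fun s : ℂ => FT3 p (fun j => s * ((β j : ℝ) : ℂ)))
      =ᶠ[nhds (⟨1, 2 * η₀ + 1⟩ : ℂ)] 0 := by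
    filter_upwards [hopen.mem_nhds hmem] with s hs
    have hs' : (2 : ℂ) * (((s.re / 2 : ℝ) : ℂ) + ((s.im / 2 : ℝ) : ℂ) * Complex.I) = s := by
      conv_rhs => rw [← Complex.re_add_im s]
      push_cast
      ring
    have := h (s.re / 2) (by linarith [hs.1]) (s.im / 2) (by linarith [hs.2])
    rwa [hs'] at this
  have hana : AnalyticOnNhd ℂ (fun s : ℂ => FT3 p (fun j => s * ((β j : ℝ) : ℂ))) Set.univ :=
    fun s _ => hd.analyticAt s
  exact hana.eqOn_zero_of_preconnected_of_eventuallyEq_zero isPreconnected_univ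
    (Set.mem_univ _) hev (Set.mem_univ s)

theorem exists_mem_sphere2_smul_eq (w : E3) : ∃ β ∈ sphere2, w = ‖w‖ • β := by
  by_cases hw : w = 0
  · exact ⟨EuclideanSpace.single 0 1, by simp [sphere2], by simp [hw]⟩
  · exact ⟨‖w‖⁻¹ • w, norm_smul_inv_norm (𝕜 := ℝ) hw, by simp [smul_smul, hw]⟩

/-- If the entire extension of the Fourier transform of a compactly supported integrable
function `p` vanishes at all points `2(k+iη)β`, `k > 0`, `η > η₀`, `β ∈ S²`,
then `p = 0` a.e. -/
theorem vanishing_on_complex_backscattering_set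
    (a : ℝ) (ha : 0 < a) (p : E3 → ℂ) (hp : Integrable p)
    (hsupp : ∀ x : E3, a < ‖x‖ → p x = 0)
    (η₀ : ℝ) (hη₀ : 0 < η₀)
    (h : ∀ k > (0 : ℝ), ∀ η > η₀, ∀ β ∈ sphere2,
      FT3 p (fun j => 2 * ((k : ℂ) + (η : ℂ) * Complex.I) * ((β j : ℝ) : ℂ)) = 0) :
    p =ᵐ[volume] 0 := by
  refine ae_eq_zero_of_fourier_eq_zero hp fun w => ?_
  obtain ⟨β, hβ, hw⟩ := exists_mem_sphere2_smul_eq w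
  rw [fourier_eq_FT3, ← FT3_line_eq_zero hp hsupp hβ (fun k hk η hη => h k hk η hη β hβ)
    (((-2 * Real.pi : ℝ) : ℂ) * (‖w‖ : ℂ))]
  congr 1 with j
  conv_lhs => rw [hw]
  simp [mul_assoc]
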